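/- Let A₁, …, A_N be n×n positive definite complex matrices, let ω = (w₁, …, w_N) be a positive probability vector, and let p, q satisfy 0 < p ≤ q ≤ 1. Then Q_{-q}(ω; A₁, …, A_N) ⪯ Q_{-p}(ω; A₁, …, A_N) in the near-order. -/

import Mathlib

open Matrix
open scoped ComplexOrder

/-- Real power of a matrix via functional calculus on the spectrum (junk value
if the matrix is not Hermitian). -/
noncomputable def mrpow {n : ℕ} (A : Matrix (Fin n) (Fin n) ℂ) (r : ℝ) :
    Matrix (Fin n) (Fin n) ℂ :=
  if hA : A.IsHermitian then
    (hA.eigenvectorUnitary : Matrix (Fin n) (Fin n) ℂ) *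
      diagonal (fun i => ((hA.eigenvalues i ^ r : ℝ) : ℂ)) *
      (star (hA.eigenvectorUnitary : Matrix (Fin n) (Fin n) ℂ))
  else A

/-- The metric geometric mean `A # B = A^{1/2} (A^{-1/2} B A^{-1/2})^{1/2} A^{1/2}`. -/
noncomputable def sharp {n : ℕ} (A B : Matrix (Fin n) (Fin n) ℂ) :
    Matrix (Fin n) (Fin n) ℂ :=
  mrpow A (1/2) * mrpow (mrpow A (-(1/2)) * B * mrpow A (-(1/2))) (1/2) * mrpow A (1/2)

/-- The Loewner order `A ≤ B`, i.e. `B - A` is positive semidefinite. -/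
def loewnerLE {n : ℕ} (A B : Matrix (Fin n) (Fin n) ℂ) : Prop := (B - A).PosSemidef

/-- The near-order `A ⪯ B`, i.e. `A⁻¹ # B ≥ I` in the Loewner order. -/
def nearLE {n : ℕ} (A B : Matrix (Fin n) (Fin n) ℂ) : Prop := loewnerLE 1 (sharp A⁻¹ B)

/-- The quasi-arithmetic mean `Q_p(ω; A₁, …, A_N) = (Σⱼ wⱼ Aⱼ^p)^{1/p}`. -/
noncomputable def quasiArith {n N : ℕ} (w : Fin N → ℝ) (p : ℝ)
    (A : Fin N → Matrix (Fin n) (Fin n) ℂ) : Matrix (Fin n) (Fin n) ℂ :=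
  mrpow (∑ j, w j • mrpow (A j) p) (1/p)

section Abstract

variable {R : Type*} [CStarAlgebra R] [PartialOrder R] [StarOrderedRing R]

/-- The geometric mean in an abstract C⋆-algebra. -/
noncomputable def shp (x y : R) : R :=
  x ^ (1/2 : ℝ) * (x ^ (-(1/2) : ℝ) * y * x ^ (-(1/2) : ℝ)) ^ (1/2 : ℝ) * x ^ (1/2 : ℝ)

lemma conj_mono {a b c : R} (hc : IsSelfAdjoint c) (h : a ≤ b) : c * a * c ≤ c * b * c :=
  hc.conjugate_le_conjugate h

lemma rpow_sa (a : R) (y : ℝ) : IsSelfAdjoint (a ^ y) :=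
  (CFC.rpow_nonneg (a := a) (y := y)).isSelfAdjoint

lemma half_mul_half {a : R} (ha : 0 ≤ a) : a ^ (1/2 : ℝ) * a ^ (1/2 : ℝ) = a := by
  rw [← CFC.sqrt_eq_rpow, CFC.sqrt_mul_sqrt_self a ha]

lemma half_mul_self {a : R} (ha : 0 ≤ a) : (a * a) ^ (1/2 : ℝ) = a := by
  rw [← CFC.sqrt_eq_rpow, CFC.sqrt_mul_self a ha]

lemma le_of_mul_self_le {a b : R} (ha : 0 ≤ a) (hb : 0 ≤ b) (h : a * a ≤ b * b) : a ≤ b := by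
  have := CFC.sqrt_le_sqrt _ _ h
  rwa [CFC.sqrt_mul_self a ha, CFC.sqrt_mul_self b hb] at this

lemma inv_anti {a b : R} (ha : IsStrictlyPositive a) (h : a ≤ b) :
    b ^ (-1 : ℝ) ≤ a ^ (-1 : ℝ) := by
  have hb : IsStrictlyPositive b := ha.of_le h
  exact CStarAlgebra.rpow_neg_one_le_rpow_neg_one h ha

lemma mul_half_neg {a : R} (ha : IsStrictlyPositive a) :
    a ^ (-(1/2) : ℝ) * a ^ (-(1/2) : ℝ) = a ^ (-1 : ℝ) := by
  rw [← CFC.rpow_add ha.isUnit]; norm_num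

lemma one_le_shp_of_le {a b : R} (hb : IsStrictlyPositive b) (h : b ≤ a) :
    1 ≤ shp a (b ^ (-1 : ℝ)) := by
  have ha : IsStrictlyPositive a := hb.of_le h
  have h1 := conj_mono (rpow_sa a (-(1/2))) (inv_anti hb h)
  have h2 : a ^ (-(1/2) : ℝ) * a ^ (-1 : ℝ) * a ^ (-(1/2) : ℝ) = a ^ (-1 : ℝ) * a ^ (-1 : ℝ) := by
    rw [← CFC.rpow_add ha.isUnit, ← CFC.rpow_add ha.isUnit, ← CFC.rpow_add ha.isUnit]; norm_num
  rw [h2] at h1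
  have h3 := CFC.rpow_le_rpow (p := 1/2) (by constructor <;> norm_num) h1
  rw [half_mul_self CFC.rpow_nonneg] at h3
  have h4 := conj_mono (rpow_sa a (1/2)) h3
  have h5 : a ^ (1/2 : ℝ) * a ^ (-1 : ℝ) * a ^ (1/2 : ℝ) = 1 := by
    rw [← CFC.rpow_add ha.isUnit, ← CFC.rpow_add ha.isUnit]; norm_num
    exact CFC.rpow_zero a ha.nonneg
  rw [h5] at h4
  exact h4

lemma one_le_shp_sq {x y : R} (hx : IsStrictlyPositive x) (hy : IsStrictlyPositive y)
    (h : 1 ≤ shp x y) : 1 ≤ shp (x * x) (y * y) := by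
  have hE1 : (x * x) ^ (1/2 : ℝ) = x := half_mul_self hx.nonneg
  have hE2 : (x * x) ^ (-(1/2) : ℝ) = x ^ (-1 : ℝ) := by
    have : x * x = x ^ (2 : ℝ) := by
      rw [show (2:ℝ) = 1 + 1 by norm_num, CFC.rpow_add hx.isUnit, CFC.rpow_one x hx.nonneg]
    rw [this, CFC.rpow_rpow x _ _ (by norm_num) hx]; norm_num
  unfold shp at h ⊢
  rw [hE1, hE2]
  have hss := half_mul_half hx.nonneg
  have htt := mul_half_neg hx
  have hst := CFC.rpow_mul_rpow_neg (1/2) hx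
  have hts := CFC.rpow_neg_mul_rpow (1/2) hx
  have hssa := rpow_sa x (1/2)
  have htsa := rpow_sa x (-(1/2))
  have hsu : IsUnit (x ^ (1/2 : ℝ)) := (IsStrictlyPositive.rpow x (1/2) hx).isUnit
  have htu : IsUnit (x ^ (-(1/2) : ℝ)) := (IsStrictlyPositive.rpow x (-(1/2)) hx).isUnit
  have hxi : x ^ (-1 : ℝ) * x = 1 := by
    have := CFC.rpow_neg_mul_rpow 1 hx
    rwa [CFC.rpow_one x hx.nonneg] at this
  have hixsa := rpow_sa x (-1)
  have hxx : (x ^ (-1 : ℝ)) ^ (-1 : ℝ) = x := by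
    rw [CFC.rpow_rpow x _ _ (by norm_num) hx]; norm_num; exact CFC.rpow_one x hx.nonneg
  have hixp : IsStrictlyPositive (x ^ (-1 : ℝ)) := IsStrictlyPositive.rpow x (-1) hx
  generalize x ^ (1/2 : ℝ) = s at *
  generalize x ^ (-(1/2) : ℝ) = t at *
  generalize x ^ (-1 : ℝ) = i at *
  have hc : IsStrictlyPositive (t * y * t) :=
    IsStrictlyPositive.conjugate_of_isUnit_of_isSelfAdjoint y t htu htsa hy
  have hyc : s * (t * y * t) * s = y := by
    calc _ = (s * t) * y * (t * s) := by noncomm_ring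
      _ = y := by rw [hst, hts]; simp
  have hcsa := hc.isSelfAdjoint
  generalize t * y * t = c at *
  have hDp : IsStrictlyPositive (c ^ (1/2 : ℝ)) := IsStrictlyPositive.rpow c _ hc
  have hDD := half_mul_half hc.nonneg
  generalize c ^ (1/2 : ℝ) = D at *
  have hiD : i ≤ D := by
    have := conj_mono htsa h
    have e : t * (s * D * s) * t = D := by
      calc _ = (t * s) * D * (s * t) := by noncomm_ring
        _ = D := by rw [hst, hts]; simp
    rwa [e, mul_one, htt] at this
  have hDx : D ^ (-1 : ℝ) ≤ x := by
    have := inv_anti hixp hiD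
    rwa [hxx] at this
  have hEn : 0 ≤ i * (y * y) * i := by
    have hysa := hy.isSelfAdjoint
    have := hysa.mul_self_nonneg
    have h2 := conj_mono hixsa this
    simpa using h2
  have hEE := half_mul_half hEn
  have hE0 : 0 ≤ (i * (y * y) * i) ^ (1/2 : ℝ) := CFC.rpow_nonneg
  generalize (i * (y * y) * i) ^ (1/2 : ℝ) = E at *
  have hW0 : 0 ≤ s * E * s := by simpa using conj_mono hssa hE0
  have hsi : s * i = t := by rw [← htt, ← mul_assoc, hst, one_mul]
  have his : i * s = t := by rw [← htt, mul_assoc, hts, mul_one]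
  have hWiW : (s * E * s) * i * (s * E * s) = c * x * c := by
    calc _ = s * E * (s * i * s) * E * s := by noncomm_ring
      _ = s * (E * E) * s := by rw [hsi, hts]; noncomm_ring
      _ = (s * i) * (y * y) * (i * s) := by rw [hEE]; noncomm_ring
      _ = t * y * y * t := by rw [hsi, his]; noncomm_ring
      _ = (t * s) * c * (s * s) * c * (s * t) := by rw [← hyc]; noncomm_ring
      _ = c * x * c := by rw [hts, hst, hss]; simp
  have hZ : x * E * x = s * (s * E * s) * s := by rw [← hss]; noncomm_ring
  rw [hZ]
  generalize s * E * s = W at *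
  have hWsa := hW0.isSelfAdjoint
  have h1 : c * D ^ (-1 : ℝ) * c ≤ W * D * W :=
    (conj_mono hcsa hDx).trans (hWiW ▸ conj_mono hWsa hiD)
  have h2 : c * D ^ (-1 : ℝ) * c = D * D * D := by
    have a1 : D * D ^ (-1 : ℝ) = 1 := by
      have := CFC.rpow_mul_rpow_neg 1 hDp
      rwa [CFC.rpow_one D hDp.nonneg] at this
    calc _ = D * (D * D ^ (-1 : ℝ)) * (D * D) := by rw [← hDD]; noncomm_ring
      _ = _ := by rw [a1]; noncomm_ring
  rw [h2] at h1
  have hee := half_mul_half hDp.nonneg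
  have hesa := rpow_sa D (1/2)
  have hfsa := rpow_sa D (-(1/2))
  have hef := CFC.rpow_mul_rpow_neg (1/2) hDp
  have hfe := CFC.rpow_neg_mul_rpow (1/2) hDp
  generalize D ^ (1/2 : ℝ) = e at *
  generalize D ^ (-(1/2) : ℝ) = f at *
  have h3 := conj_mono hesa h1
  have h4 : e * (D * D * D) * e = (D * D) * (D * D) := by rw [← hee]; noncomm_ring
  have h5 : e * (W * D * W) * e = (e * W * e) * (e * W * e) := by rw [← hee]; noncomm_ring
  rw [h4, h5] at h3
  have h6 : D * D ≤ e * W * e :=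
    le_of_mul_self_le hDp.isSelfAdjoint.mul_self_nonneg (by simpa using conj_mono hesa hW0) h3
  have h7 := conj_mono hfsa h6
  have h8 : f * (D * D) * f = D := by
    calc _ = (f * e) * (e * e) * (e * f) := by rw [← hee]; noncomm_ring
      _ = D := by rw [hfe, hef, hee]; simp
  have h9 : f * (e * W * e) * f = W := by
    calc _ = (f * e) * W * (e * f) := by noncomm_ring
      _ = W := by rw [hfe, hef]; simp
  rw [h8, h9] at h7
  exact h.trans (conj_mono hssa h7)

lemma one_le_shp_pow {x y : R} (hx : IsStrictlyPositive x) (hy : IsStrictlyPositive y)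
    (h : 1 ≤ shp x y) (k : ℕ) :
    1 ≤ shp (x ^ ((2:ℝ) ^ k)) (y ^ ((2:ℝ) ^ k)) := by
  induction k with
  | zero => simpa [CFC.rpow_one x hx.nonneg, CFC.rpow_one y hy.nonneg] using h
  | succ k ih =>
    have := one_le_shp_sq (IsStrictlyPositive.rpow x _ hx) (IsStrictlyPositive.rpow y _ hy) ih
    rw [← CFC.rpow_add hx.isUnit, ← CFC.rpow_add hy.isUnit] at this
    rwa [pow_succ, mul_two]

lemma sum_sp {N : ℕ} {B : Fin N → R} (hB : ∀ j, IsStrictlyPositive (B j))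
    {w : Fin N → ℝ} (hw : ∀ j, 0 < w j) (hw1 : ∑ j, w j = 1) :
    IsStrictlyPositive (∑ j, w j • B j) := by
  have hne : (Finset.univ : Finset (Fin N)).Nonempty := by
    by_contra hne
    rw [Finset.not_nonempty_iff_eq_empty] at hne
    rw [hne] at hw1
    simp at hw1
  obtain ⟨j, hj⟩ := hne
  refine (IsStrictlyPositive.smul (hw j) (hB j)).of_le ?_
  exact Finset.single_le_sum (f := fun j => w j • B j)
    (fun i _ => smul_nonneg (hw i).le (hB i).nonneg) hj

lemma abstract_main {N : ℕ} (A : Fin N → R) (hA : ∀ j, IsStrictlyPositive (A j))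
    (w : Fin N → ℝ) (hw : ∀ j, 0 < w j) (hw1 : ∑ j, w j = 1)
    (p q : ℝ) (hp0 : 0 < p) (hpq : p ≤ q) :
    1 ≤ shp ((∑ j, w j • A j ^ (-q)) ^ (1/q)) ((∑ j, w j • A j ^ (-p)) ^ (1/(-p))) := by
  have hq0 : 0 < q := hp0.trans_le hpq
  have hS : IsStrictlyPositive (∑ j, w j • A j ^ (-q)) :=
    sum_sp (fun j => IsStrictlyPositive.rpow _ _ (hA j)) hw hw1
  have hT : IsStrictlyPositive (∑ j, w j • A j ^ (-p)) :=
    sum_sp (fun j => IsStrictlyPositive.rpow _ _ (hA j)) hw hw1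
  have hle : ∑ j, w j • A j ^ (-p) ≤ (∑ j, w j • A j ^ (-q)) ^ (p/q) := by
    have hc := CFC.concaveOn_rpow (A := R) (p := p/q)
      ⟨by positivity, (div_le_one hq0).2 hpq⟩
    have := hc.le_map_sum (t := Finset.univ) (w := w) (p := fun j => A j ^ (-q))
      (fun i _ => (hw i).le) hw1 (fun i _ => CFC.rpow_nonneg)
    refine le_trans (le_of_eq ?_) this
    refine Finset.sum_congr rfl fun j _ => ?_
    rw [CFC.rpow_rpow _ _ _ (by linarith) (hA j)]
    congr 2
    field_simp
  generalize (∑ j, w j • A j ^ (-q)) = S at *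
  generalize (∑ j, w j • A j ^ (-p)) = T at *
  obtain ⟨k, hk⟩ := pow_unbounded_of_one_lt (1/p) (one_lt_two (α := ℝ))
  have h2k : (0:ℝ) < 2 ^ k := by positivity
  have hu : 1 / (p * 2 ^ k) ∈ Set.Icc (0:ℝ) 1 := by
    refine ⟨by positivity, ?_⟩
    rw [div_le_one (by positivity)]
    rw [div_lt_iff₀ hp0] at hk
    linarith
  have h1 := CFC.rpow_le_rpow hu hle
  have h2 := one_le_shp_pow (IsStrictlyPositive.rpow _ _ (IsStrictlyPositive.rpow _ _ hS))
    (IsStrictlyPositive.rpow _ _ (IsStrictlyPositive.rpow _ _ hT))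
    (one_le_shp_of_le (IsStrictlyPositive.rpow _ _ hT) h1) k
  rw [CFC.rpow_rpow S _ _ (by positivity) hS, CFC.rpow_rpow S _ _ (by positivity) hS,
    CFC.rpow_rpow T _ _ (by positivity) hT,
    CFC.rpow_rpow T _ _ (mul_ne_zero (by positivity) (by norm_num)) hT] at h2
  convert h2 using 3
  · field_simp
  · field_simp

end Abstract

section Transfer

open scoped MatrixOrder Matrix.Norms.L2Operator

lemma mrpow_eq {n : ℕ} {A : Matrix (Fin n) (Fin n) ℂ} (hA : 0 ≤ A) (r : ℝ) :
    mrpow A r = A ^ r := by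
  have hH : A.IsHermitian := hA.posSemidef.1
  rw [CFC.rpow_eq_cfc_real hA, hH.cfc_eq, mrpow, dif_pos hH]
  rfl

lemma sharp_eq {n : ℕ} {A B : Matrix (Fin n) (Fin n) ℂ} (hA : 0 ≤ A) (hB : 0 ≤ B) :
    sharp A B = shp A B := by
  unfold sharp shp
  rw [mrpow_eq hA, mrpow_eq hA, mrpow_eq]
  simpa using conj_mono (rpow_sa A (-(1/2))) hB

lemma quasiArith_eq {n N : ℕ} {A : Fin N → Matrix (Fin n) (Fin n) ℂ}
    (hA : ∀ j, IsStrictlyPositive (A j))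
    {w : Fin N → ℝ} (hw : ∀ j, 0 < w j) (hw1 : ∑ j, w j = 1) (p : ℝ) :
    quasiArith w p A = (∑ j, w j • A j ^ p) ^ (1/p) := by
  unfold quasiArith
  have : (∑ j, w j • mrpow (A j) p) = ∑ j, w j • A j ^ p :=
    Finset.sum_congr rfl fun j _ => by rw [mrpow_eq (hA j).nonneg]
  rw [this, mrpow_eq]
  exact (sum_sp (fun j => IsStrictlyPositive.rpow _ _ (hA j)) hw hw1).nonneg

lemma main_aux {n N : ℕ}
    (A : Fin N → Matrix (Fin n) (Fin n) ℂ) (hA : ∀ j, (A j).PosDef)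
    (w : Fin N → ℝ) (hw : ∀ j, 0 < w j) (hw1 : ∑ j, w j = 1)
    (p q : ℝ) (hp0 : 0 < p) (hpq : p ≤ q) :
    nearLE (quasiArith w (-q) A) (quasiArith w (-p) A) := by
  have hA' : ∀ j, IsStrictlyPositive (A j) := fun j => (hA j).isStrictlyPositive
  have hq0 : 0 < q := hp0.trans_le hpq
  have hS : IsStrictlyPositive (∑ j, w j • A j ^ (-q)) :=
    sum_sp (fun j => IsStrictlyPositive.rpow _ _ (hA' j)) hw hw1
  have hinv : (quasiArith w (-q) A)⁻¹ = (∑ j, w j • A j ^ (-q)) ^ (1/q) := by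
    rw [quasiArith_eq hA' hw hw1]
    apply Matrix.inv_eq_left_inv
    rw [show 1 / -q = -(1/q) by field_simp]
    exact CFC.rpow_mul_rpow_neg _ hS
  unfold nearLE
  rw [hinv, quasiArith_eq hA' hw hw1, sharp_eq CFC.rpow_nonneg CFC.rpow_nonneg]
  exact abstract_main A hA' w hw hw1 p q hp0 hpq

end Transfer

theorem quasiArith_nearLE_quasiArith_neg {n N : ℕ}
    (A : Fin N → Matrix (Fin n) (Fin n) ℂ) (hA : ∀ j, (A j).PosDef)
    (w : Fin N → ℝ) (hw : ∀ j, 0 < w j) (hw1 : ∑ j, w j = 1)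
    (p q : ℝ) (hp0 : 0 < p) (hpq : p ≤ q) (hq1 : q ≤ 1) :
    nearLE (quasiArith w (-q) A) (quasiArith w (-p) A) := by
  exact main_aux A hA w hw hw1 p q hp0 hpq
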